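/- Let p>2, let u be a nonnegative classical solution of u_t−Δu=|∇u|^p in Q_T with u=0 on Γ_T, having an isolated gradient blowup point at (0,0,T) and satisfying the monotonicity condition x·u_x≤0 in Q_T. Then limsup_{t→T⁻} u_y(0,0,t) = +∞, and there exists C₁>0 such that u_y(0,y,T) ≥ d_p y^{−β} − C₁ for all 0<y<L/2, where β=1/(p−1) and d_p=β^β. -/

import Mathlib

open Real Set Filter MeasureTheory

noncomputable section

/-- Partial derivative of `u(x,y,t)` with respect to `x`. -/
def pdx (u : ℝ → ℝ → ℝ → ℝ) (x y t : ℝ) : ℝ := deriv (fun s => u s y t) x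

/-- Partial derivative with respect to `y`. -/
def pdy (u : ℝ → ℝ → ℝ → ℝ) (x y t : ℝ) : ℝ := deriv (fun s => u x s t) y

/-- Partial derivative with respect to `t`. -/
def pdt (u : ℝ → ℝ → ℝ → ℝ) (x y t : ℝ) : ℝ := deriv (fun s => u x y s) t

/-- Second partial derivative with respect to `x`. -/
def pdxx (u : ℝ → ℝ → ℝ → ℝ) (x y t : ℝ) : ℝ := deriv (fun s => pdx u s y t) x

/-- Second partial derivative with respect to `y`. -/
def pdyy (u : ℝ → ℝ → ℝ → ℝ) (x y t : ℝ) : ℝ := deriv (fun s => pdy u x s t) y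

/-- Mixed second partial derivative `u_{xy}` (first `x`, then `y`). -/
def pdxy (u : ℝ → ℝ → ℝ → ℝ) (x y t : ℝ) : ℝ := deriv (fun s => pdx u x s t) y

/-- The norm of the spatial gradient, `|∇u| = (u_x² + u_y²)^{1/2}`. -/
def gradNorm (u : ℝ → ℝ → ℝ → ℝ) (x y t : ℝ) : ℝ :=
  Real.sqrt ((pdx u x y t) ^ 2 + (pdy u x y t) ^ 2)

/-- `C^{2,1}`-type regularity of `u` at the point `(x,y,t)`: twice (continuously)
differentiable in the space variables and once in time. -/
def C21At (u : ℝ → ℝ → ℝ → ℝ) (x y t : ℝ) : Prop :=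
  DifferentiableAt ℝ (fun s => u s y t) x ∧
  DifferentiableAt ℝ (fun s => u x s t) y ∧
  DifferentiableAt ℝ (fun s => u x y s) t ∧
  DifferentiableAt ℝ (fun s => pdx u s y t) x ∧
  DifferentiableAt ℝ (fun s => pdy u x s t) y ∧
  DifferentiableAt ℝ (fun s => pdx u x s t) y ∧
  ContinuousAt (fun q : ℝ × ℝ × ℝ => u q.1 q.2.1 q.2.2) (x, y, t) ∧
  ContinuousAt (fun q : ℝ × ℝ × ℝ => pdx u q.1 q.2.1 q.2.2) (x, y, t) ∧
  ContinuousAt (fun q : ℝ × ℝ × ℝ => pdy u q.1 q.2.1 q.2.2) (x, y, t) ∧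
  ContinuousAt (fun q : ℝ × ℝ × ℝ => pdt u q.1 q.2.1 q.2.2) (x, y, t) ∧
  ContinuousAt (fun q : ℝ × ℝ × ℝ => pdxx u q.1 q.2.1 q.2.2) (x, y, t) ∧
  ContinuousAt (fun q : ℝ × ℝ × ℝ => pdyy u q.1 q.2.1 q.2.2) (x, y, t) ∧
  ContinuousAt (fun q : ℝ × ℝ × ℝ => pdxy u q.1 q.2.1 q.2.2) (x, y, t)

/-- `u` is a nonnegative classical solution of `u_t - Δu = |∇u|^p` in
`Q_T = ω × (0,T)`, `ω = (-L,L) × (0,L)`, with `u = 0` on `Γ_T = (-L,L) × {0} × (0,T)`. -/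
structure ClassicalSolution (p L T : ℝ) (u : ℝ → ℝ → ℝ → ℝ) : Prop where
  nonneg : ∀ ⦃x y t : ℝ⦄, |x| ≤ L → y ∈ Icc (0:ℝ) L → t ∈ Ioo 0 T → 0 ≤ u x y t
  smooth : ∀ ⦃x y t : ℝ⦄, |x| ≤ L → y ∈ Icc (0:ℝ) L → t ∈ Ioo 0 T → C21At u x y t
  pde : ∀ ⦃x y t : ℝ⦄, |x| < L → y ∈ Ioo (0:ℝ) L → t ∈ Ioo 0 T →
    pdt u x y t - (pdxx u x y t + pdyy u x y t) = gradNorm u x y t ^ p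
  bc : ∀ ⦃x t : ℝ⦄, |x| < L → t ∈ Ioo 0 T → u x 0 t = 0

/-- `u` has an isolated gradient blow-up point at `(0,0,T)`:
`limsup |∇u| = ∞` at `(0,0,T)` while `∇u` stays bounded on `K × (0,T)` for every
compact `K ⊆ ω̄ \ {(0,0)}`. -/
structure IsolatedGBU (L T : ℝ) (u : ℝ → ℝ → ℝ → ℝ) : Prop where
  blowup : ∀ M : ℝ, ∀ δ > (0:ℝ), ∃ x y t : ℝ, |x| ≤ L ∧ y ∈ Icc (0:ℝ) L ∧
    t ∈ Ioo 0 T ∧ |x| < δ ∧ |y| < δ ∧ T - δ < t ∧ M < gradNorm u x y t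
  bounded : ∀ K : Set (ℝ × ℝ), IsCompact K →
    K ⊆ (Icc (-L) L ×ˢ Icc (0:ℝ) L) \ {((0:ℝ), (0:ℝ))} →
    ∃ M : ℝ, ∀ q ∈ K, ∀ t ∈ Ioo (0:ℝ) T, gradNorm u q.1 q.2 t ≤ M

/-- `u` extends as a `C^{2,1}` function to `(ω̄' × [T/2,T]) \ {(0,0,T)}`,
`ω' = (-L/2,L/2) × (0,L/2)`; values and derivatives at `t = T` refer to this extension. -/
def ExtC21 (L T : ℝ) (u : ℝ → ℝ → ℝ → ℝ) : Prop :=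
  ∀ ⦃x y t : ℝ⦄, |x| ≤ L / 2 → y ∈ Icc (0:ℝ) (L / 2) → t ∈ Icc (T / 2) T →
    ¬(x = 0 ∧ y = 0 ∧ t = T) → C21At u x y t

/-- The monotonicity condition `x·u_x ≤ 0` in `Q_T`. -/
def MonCond (L T : ℝ) (u : ℝ → ℝ → ℝ → ℝ) : Prop :=
  ∀ ⦃x y t : ℝ⦄, |x| < L → y ∈ Ioo (0:ℝ) L → t ∈ Ioo 0 T → x * pdx u x y t ≤ 0

lemma second_deriv_max {f : ℝ → ℝ} {s : ℝ} (hd : ∀ᶠ z in nhds s, DifferentiableAt ℝ f z)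
    (hm : IsLocalMax f s) : deriv f s = 0 ∧ deriv (deriv f) s ≤ 0 := by
  have h0 := hm.deriv_eq_zero
  refine ⟨h0, ?_⟩
  by_contra! hc
  have hmin := isLocalMin_of_deriv_deriv_pos hc h0 hd.self_of_nhds.continuousAt
  have heq : f =ᶠ[nhds s] fun _ => f s := by
    filter_upwards [hm, hmin] with z h1 h2
    exact le_antisymm h1 h2
  have := heq.deriv.deriv_eq
  simp at this
  linarith

lemma second_deriv_max_sub {f g : ℝ → ℝ} {s : ℝ} (hf : ∀ᶠ z in nhds s, DifferentiableAt ℝ f z)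
    (hg : ∀ᶠ z in nhds s, DifferentiableAt ℝ g z)
    (hf2 : DifferentiableAt ℝ (deriv f) s) (hg2 : DifferentiableAt ℝ (deriv g) s)
    (hm : IsLocalMax (fun z => f z - g z) s) :
    deriv f s = deriv g s ∧ deriv (deriv f) s ≤ deriv (deriv g) s := by
  have hd : ∀ᶠ z in nhds s, DifferentiableAt ℝ (fun z => f z - g z) z := by
    filter_upwards [hf, hg] with z h1 h2 using h1.sub h2
  obtain ⟨h1, h2⟩ := second_deriv_max hd hm
  have he : deriv (fun z => f z - g z) =ᶠ[nhds s] fun z => deriv f z - deriv g z := by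
    filter_upwards [hf, hg] with z h1 h2 using deriv_fun_sub h1 h2
  rw [he.self_of_nhds] at h1
  rw [he.deriv_eq, deriv_fun_sub hf2 hg2] at h2
  exact ⟨by linarith, by linarith⟩

lemma left_max_deriv {f : ℝ → ℝ} {a t f' : ℝ} (hat : a < t) (hf : HasDerivAt f f' t)
    (hm : ∀ s ∈ Icc a t, f s ≤ f t) : 0 ≤ f' := by
  have h1 : Tendsto (slope f t) (nhdsWithin t (Iio t)) (nhds f') :=
    (hasDerivWithinAt_iff_tendsto_slope' (by simp)).1 (hf.hasDerivWithinAt (s := Iio t))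
  refine ge_of_tendsto h1 ?_
  filter_upwards [Ioo_mem_nhdsLT hat] with s hs
  rw [slope_def_field]
  exact div_nonneg_of_nonpos (by linarith [hm s ⟨hs.1.le, hs.2.le⟩]) (by linarith [hs.2])

/-- regular solution on a box -/
def GoodSol (p a t0 τ : ℝ) (v : ℝ → ℝ → ℝ → ℝ) : Prop :=
  (∀ x y t, |x| ≤ a → y ∈ Icc (0:ℝ) a → t ∈ Icc t0 τ → C21At v x y t) ∧
  (∀ x y t, |x| < a → y ∈ Ioo (0:ℝ) a → t ∈ Icc t0 τ →
    pdt v x y t - (pdxx v x y t + pdyy v x y t) = gradNorm v x y t ^ p)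

lemma comparison {p a t0 τ C : ℝ} {v w : ℝ → ℝ → ℝ → ℝ}
    (hv : GoodSol p a t0 τ v) (hw : GoodSol p a t0 τ w)
    (hb : ∀ x y t, |x| ≤ a → y ∈ Icc (0:ℝ) a → t ∈ Icc t0 τ →
      (|x| = a ∨ y = 0 ∨ y = a ∨ t = t0) → v x y t - w x y t ≤ C) :
    ∀ x y t, |x| ≤ a → y ∈ Icc (0:ℝ) a → t ∈ Icc t0 τ → v x y t - w x y t ≤ C := by
  intro x y t hx hy ht
  have key : ∀ ε > 0, v x y t - w x y t ≤ C + ε * (t - t0) := by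
    intro ε hε
    set K : Set (ℝ × ℝ × ℝ) := Icc (-a) a ×ˢ (Icc 0 a ×ˢ Icc t0 τ) with hK
    have hKc : IsCompact K := isCompact_Icc.prod (isCompact_Icc.prod isCompact_Icc)
    have hne : K.Nonempty := ⟨(x, y, t), abs_le.1 hx, hy, ht⟩
    have hcont : ContinuousOn (fun q : ℝ × ℝ × ℝ =>
        v q.1 q.2.1 q.2.2 - w q.1 q.2.1 q.2.2 - ε * (q.2.2 - t0)) K := by
      rintro ⟨x, y, t⟩ ⟨h1, h2, h3⟩
      apply ContinuousAt.continuousWithinAt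
      have c1 := (hv.1 x y t (abs_le.2 h1) h2 h3).2.2.2.2.2.2.1
      have c2 := (hw.1 x y t (abs_le.2 h1) h2 h3).2.2.2.2.2.2.1
      have c3 : ContinuousAt (fun q : ℝ × ℝ × ℝ => ε * (q.2.2 - t0)) (x, y, t) := by fun_prop
      exact (c1.sub c2).sub c3
    obtain ⟨⟨x1, y1, t1⟩, ⟨h1, h2, h3⟩, hmax⟩ := hKc.exists_isMaxOn hne hcont
    have hmax' : ∀ x y t, |x| ≤ a → y ∈ Icc (0:ℝ) a → t ∈ Icc t0 τ →
        v x y t - w x y t - ε * (t - t0) ≤ v x1 y1 t1 - w x1 y1 t1 - ε * (t1 - t0) :=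
      fun x y t hx hy ht => hmax (show (x, y, t) ∈ K from ⟨abs_le.1 hx, hy, ht⟩)
    simp only at h1 h2 h3
    have h1' := abs_le.2 h1
    suffices hs : v x1 y1 t1 - w x1 y1 t1 ≤ C by
      have := hmax' x y t hx hy ht
      nlinarith [h3.1]
    by_cases hbd : |x1| = a ∨ y1 = 0 ∨ y1 = a ∨ t1 = t0
    · exact hb _ _ _ h1' h2 h3 hbd
    exfalso
    push Not at hbd
    obtain ⟨b1, b2, b3, b4⟩ := hbd
    have hx1 : |x1| < a := lt_of_le_of_ne h1' b1
    have hy1 : y1 ∈ Ioo 0 a := ⟨lt_of_le_of_ne h2.1 (Ne.symm b2), lt_of_le_of_ne h2.2 b3⟩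
    have ht1 : t0 < t1 := lt_of_le_of_ne h3.1 (Ne.symm b4)
    have ex : ∀ᶠ s in nhds x1, |s| < a := (continuous_abs.tendsto x1).eventually_lt_const hx1
    have ey : ∀ᶠ s in nhds y1, s ∈ Ioo 0 a := Ioo_mem_nhds hy1.1 hy1.2
    have Cv := hv.1 x1 y1 t1 h1' h2 h3
    have Cw := hw.1 x1 y1 t1 h1' h2 h3
    have X := second_deriv_max_sub (f := fun s => v s y1 t1) (g := fun s => w s y1 t1) (s := x1)
      (by filter_upwards [ex] with s hs using (hv.1 s y1 t1 hs.le h2 h3).1)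
      (by filter_upwards [ex] with s hs using (hw.1 s y1 t1 hs.le h2 h3).1)
      Cv.2.2.2.1 Cw.2.2.2.1
      (by filter_upwards [ex] with s hs; linarith [hmax' s y1 t1 hs.le h2 h3])
    have Y := second_deriv_max_sub (f := fun s => v x1 s t1) (g := fun s => w x1 s t1) (s := y1)
      (by filter_upwards [ey] with s hs using (hv.1 x1 s t1 h1' ⟨hs.1.le, hs.2.le⟩ h3).2.1)
      (by filter_upwards [ey] with s hs using (hw.1 x1 s t1 h1' ⟨hs.1.le, hs.2.le⟩ h3).2.1)
      Cv.2.2.2.2.1 Cw.2.2.2.2.1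
      (by filter_upwards [ey] with s hs; linarith [hmax' x1 s t1 h1' ⟨hs.1.le, hs.2.le⟩ h3])
    have Z := left_max_deriv (f := fun s => v x1 y1 s - w x1 y1 s - ε * (s - t0)) ht1
      ((Cv.2.2.1.hasDerivAt.sub Cw.2.2.1.hasDerivAt).sub
        (((hasDerivAt_id t1).sub_const t0).const_mul ε))
      (fun s hs => hmax' x1 y1 s h1' h2 ⟨hs.1, hs.2.trans h3.2⟩)
    have P1 := hv.2 x1 y1 t1 hx1 hy1 h3
    have P2 := hw.2 x1 y1 t1 hx1 hy1 h3
    have g : gradNorm v x1 y1 t1 = gradNorm w x1 y1 t1 := by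
      unfold gradNorm
      rw [show pdx v x1 y1 t1 = pdx w x1 y1 t1 from X.1,
        show pdy v x1 y1 t1 = pdy w x1 y1 t1 from Y.1]
    rw [g] at P1
    have X2 : pdxx v x1 y1 t1 ≤ pdxx w x1 y1 t1 := X.2
    have Y2 : pdyy v x1 y1 t1 ≤ pdyy w x1 y1 t1 := Y.2
    have Z2 : 0 ≤ pdt v x1 y1 t1 - pdt w x1 y1 t1 - ε * 1 := Z
    linarith
  by_contra! hc
  have h := key ((v x y t - w x y t - C) / (2 * (t - t0 + 1))) (by
    apply div_pos <;> linarith [ht.1])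
  have h5 : 0 < t - t0 + 1 := by linarith [ht.1]
  have h6 : (v x y t - w x y t - C) / (2 * (t - t0 + 1)) * (t - t0) ≤
      (v x y t - w x y t - C) / 2 := by
    rw [div_mul_eq_mul_div, div_le_div_iff₀ (by positivity) (by positivity)]
    nlinarith
  linarith

/-- translation -/
def shiftU (u : ℝ → ℝ → ℝ → ℝ) (h k s : ℝ) : ℝ → ℝ → ℝ → ℝ := fun x y t => u (x + h) (y + k) (t + s)

lemma pdx_shift (u : ℝ → ℝ → ℝ → ℝ) (h k s : ℝ) : pdx (shiftU u h k s) = shiftU (pdx u) h k s := by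
  funext x y t
  exact deriv_comp_add_const (fun z => u z (y + k) (t + s)) h x
lemma pdy_shift (u : ℝ → ℝ → ℝ → ℝ) (h k s : ℝ) : pdy (shiftU u h k s) = shiftU (pdy u) h k s := by
  funext x y t
  exact deriv_comp_add_const (fun z => u (x + h) z (t + s)) k y
lemma pdt_shift (u : ℝ → ℝ → ℝ → ℝ) (h k s : ℝ) : pdt (shiftU u h k s) = shiftU (pdt u) h k s := by
  funext x y t
  exact deriv_comp_add_const (fun z => u (x + h) (y + k) z) s t
lemma pdxx_shift (u : ℝ → ℝ → ℝ → ℝ) (h k s : ℝ) : pdxx (shiftU u h k s) = shiftU (pdxx u) h k s := by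
  change pdx (pdx (shiftU u h k s)) = shiftU (pdx (pdx u)) h k s
  rw [pdx_shift, pdx_shift]
lemma pdyy_shift (u : ℝ → ℝ → ℝ → ℝ) (h k s : ℝ) : pdyy (shiftU u h k s) = shiftU (pdyy u) h k s := by
  change pdy (pdy (shiftU u h k s)) = shiftU (pdy (pdy u)) h k s
  rw [pdy_shift, pdy_shift]
lemma pdxy_shift (u : ℝ → ℝ → ℝ → ℝ) (h k s : ℝ) : pdxy (shiftU u h k s) = shiftU (pdxy u) h k s := by
  change pdy (pdx (shiftU u h k s)) = shiftU (pdy (pdx u)) h k s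
  rw [pdx_shift, pdy_shift]

lemma cont_shift (u : ℝ → ℝ → ℝ → ℝ) (h k s x y t : ℝ)
    (hc : ContinuousAt (fun q : ℝ × ℝ × ℝ => u q.1 q.2.1 q.2.2) (x + h, y + k, t + s)) :
    ContinuousAt (fun q : ℝ × ℝ × ℝ => shiftU u h k s q.1 q.2.1 q.2.2) (x, y, t) := by
  have : ContinuousAt (fun q : ℝ × ℝ × ℝ => (q.1 + h, q.2.1 + k, q.2.2 + s)) (x, y, t) := by fun_prop
  exact ContinuousAt.comp (f := fun q : ℝ × ℝ × ℝ => (q.1 + h, q.2.1 + k, q.2.2 + s))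
    (g := fun q : ℝ × ℝ × ℝ => u q.1 q.2.1 q.2.2) hc this

lemma c21_shift {u : ℝ → ℝ → ℝ → ℝ} {h k s x y t : ℝ} (hu : C21At u (x + h) (y + k) (t + s)) :
    C21At (shiftU u h k s) x y t := by
  obtain ⟨a1, a2, a3, a4, a5, a6, a7, a8, a9, a10, a11, a12, a13⟩ := hu
  have D : ∀ {f : ℝ → ℝ} {z c : ℝ}, DifferentiableAt ℝ f (z + c) →
      DifferentiableAt ℝ (fun z => f (z + c)) z := fun hf => by
    rwa [differentiableAt_comp_add_const]
  unfold C21At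
  rw [pdx_shift, pdy_shift, pdt_shift, pdxx_shift, pdyy_shift, pdxy_shift]
  refine ⟨D a1, D a2, D a3, D a4, D a5, D a6, ?_, ?_, ?_, ?_, ?_, ?_, ?_⟩ <;>
    apply cont_shift <;> assumption

lemma good_shift {p L T a t0 τ h k s : ℝ} {u : ℝ → ℝ → ℝ → ℝ} (hsol : ClassicalSolution p L T u)
    (ha : 0 < a) (hh : a + |h| < L) (hk : 0 ≤ k) (hk2 : a + k < L) (hs : 0 < t0 + s)
    (hs2 : τ + s < T) : GoodSol p a t0 τ (shiftU u h k s) := by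
  constructor
  · intro x y t hx hy ht
    refine c21_shift (hsol.smooth ?_ ⟨?_, ?_⟩ ⟨?_, ?_⟩)
    · linarith [abs_add_le x h]
    all_goals linarith [hy.1, hy.2, ht.1, ht.2]
  · intro x y t hx hy ht
    have := hsol.pde (x := x + h) (y := y + k) (t := t + s) (by linarith [abs_add_le x h])
      ⟨by linarith [hy.1], by linarith [hy.2]⟩ ⟨by linarith [ht.1], by linarith [ht.2]⟩
    unfold gradNorm at *
    rw [pdx_shift, pdy_shift, pdt_shift, pdxx_shift, pdyy_shift]
    exact this

lemma shift_zero (u : ℝ → ℝ → ℝ → ℝ) : shiftU u 0 0 0 = u := by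
  funext x y t; simp [shiftU]

lemma good_self {p L T a t0 τ : ℝ} {u : ℝ → ℝ → ℝ → ℝ} (hsol : ClassicalSolution p L T u)
    (ha : 0 < a) (hL : a < L) (hs : 0 < t0) (hs2 : τ < T) : GoodSol p a t0 τ u := by
  have := good_shift (h := 0) (k := 0) (s := 0) hsol ha (by simpa) le_rfl (by simpa)
    (t0 := t0) (τ := τ) (by simpa) (by simpa)
  rwa [shift_zero] at this

lemma mvt_abs {f : ℝ → ℝ} {a b N : ℝ} (hab : a ≤ b) (hd : ∀ z ∈ Icc a b, DifferentiableAt ℝ f z)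
    (hN : ∀ z ∈ Icc a b, |deriv f z| ≤ N) : |f b - f a| ≤ N * (b - a) := by
  have := Convex.norm_image_sub_le_of_norm_deriv_le (𝕜 := ℝ) hd hN (convex_Icc a b)
    (left_mem_Icc.2 hab) (right_mem_Icc.2 hab)
  simpa [abs_of_nonneg (sub_nonneg.2 hab)] using this

lemma deriv_le_of_right {f : ℝ → ℝ} {z N k0 : ℝ} (hk0 : 0 < k0) (hd : DifferentiableAt ℝ f z)
    (h : ∀ k, 0 < k → k < k0 → f (z + k) - f z ≤ N * k) : deriv f z ≤ N := by
  have h1 : Tendsto (slope f z) (nhdsWithin z (Ioi z)) (nhds (deriv f z)) :=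
    (hasDerivWithinAt_iff_tendsto_slope' (by simp)).1 (hd.hasDerivAt.hasDerivWithinAt (s := Ioi z))
  refine le_of_tendsto h1 ?_
  filter_upwards [Ioo_mem_nhdsGT (show z < z + k0 by linarith)] with s hs
  rw [slope_def_field, div_le_iff₀ (by linarith [hs.1])]
  have := h (s - z) (by linarith [hs.1]) (by linarith [hs.2])
  simpa using this

lemma le_deriv_of_right {f : ℝ → ℝ} {z N k0 : ℝ} (hk0 : 0 < k0) (hd : DifferentiableAt ℝ f z)
    (h : ∀ k, 0 < k → k < k0 → f z - f (z + k) ≤ N * k) : -N ≤ deriv f z := by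
  have := deriv_le_of_right (f := fun z => - f z) (N := N) hk0 hd.neg
    (fun k h1 h2 => by linarith [h k h1 h2])
  rw [deriv.fun_neg] at this
  linarith

lemma bdd_compact {g : ℝ × ℝ × ℝ → ℝ} {K : Set (ℝ × ℝ × ℝ)} (hK : IsCompact K)
    (hg : ∀ q ∈ K, ContinuousAt g q) : ∃ N, 0 ≤ N ∧ ∀ q ∈ K, |g q| ≤ N := by
  obtain ⟨N, hN⟩ := hK.exists_bound_of_continuousOn
    (fun q hq => (hg q hq).continuousWithinAt)
  exact ⟨max N 0, le_max_right _ _, fun q hq => (hN q hq).trans (le_max_left _ _)⟩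

lemma mon_axis {p L T : ℝ} {u : ℝ → ℝ → ℝ → ℝ} (hsol : ClassicalSolution p L T u)
    (hmon : MonCond L T u) {x y t : ℝ} (hx : |x| < L) (hy : y ∈ Ioo 0 L) (ht : t ∈ Ioo 0 T) :
    u x y t ≤ u 0 y t := by
  have hyc : y ∈ Icc 0 L := ⟨hy.1.le, hy.2.le⟩
  have hd : ∀ z, |z| < L → DifferentiableAt ℝ (fun s => u s y t) z := fun z hz =>
    (hsol.smooth hz.le hyc ht).1
  rcases le_total 0 x with h0 | h0
  · have hz : ∀ z ∈ Icc 0 x, |z| < L := fun z hz => by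
      rw [abs_of_nonneg hz.1]; rw [abs_of_nonneg h0] at hx; linarith [hz.2]
    refine antitoneOn_of_deriv_nonpos (f := fun s => u s y t) (convex_Icc 0 x)
      (fun z h => (hd z (hz z h)).continuousAt.continuousWithinAt)
      (fun z h => (hd z (hz z (interior_subset h))).differentiableWithinAt) ?_
      (left_mem_Icc.2 h0) (right_mem_Icc.2 h0) h0
    intro z h
    have h2 := hz z (interior_subset h)
    rw [interior_Icc] at h
    exact nonpos_of_mul_nonpos_right (hmon h2 hy ht) h.1
  · have hz : ∀ z ∈ Icc x 0, |z| < L := fun z hz => by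
      rw [abs_of_nonpos hz.2]; rw [abs_of_nonpos h0] at hx; linarith [hz.1]
    refine monotoneOn_of_deriv_nonneg (f := fun s => u s y t) (convex_Icc x 0)
      (fun z h => (hd z (hz z h)).continuousAt.continuousWithinAt)
      (fun z h => (hd z (hz z (interior_subset h))).differentiableWithinAt) ?_
      (left_mem_Icc.2 h0) (right_mem_Icc.2 h0) h0
    intro z h
    have h2 := hz z (interior_subset h)
    rw [interior_Icc] at h
    have := hmon h2 hy ht
    by_contra! hc
    have : 0 < z * pdx u z y t := mul_pos_of_neg_of_neg h.2 hc
    linarith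

lemma axis_max {p L T : ℝ} {u : ℝ → ℝ → ℝ → ℝ} (hL : 0 < L) (hsol : ClassicalSolution p L T u)
    (hmon : MonCond L T u) {y t : ℝ} (hy : y ∈ Ioo 0 L) (ht : t ∈ Ioo 0 T) :
    pdx u 0 y t = 0 ∧ pdxx u 0 y t ≤ 0 := by
  have ex : ∀ᶠ s in nhds (0:ℝ), |s| < L :=
    (continuous_abs.tendsto (0:ℝ)).eventually_lt_const (by simpa using hL)
  refine second_deriv_max (f := fun s => u s y t) ?_ ?_
  · filter_upwards [ex] with s hs using (hsol.smooth hs.le ⟨hy.1.le, hy.2.le⟩ ht).1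
  · filter_upwards [ex] with s hs using mon_axis hsol hmon hs hy ht

lemma ut_lower {p L T : ℝ} {u : ℝ → ℝ → ℝ → ℝ} (hL : 0 < L) (hT : 0 < T)
    (hsol : ClassicalSolution p L T u) (hext : ExtC21 L T u) :
    ∃ C, 0 ≤ C ∧ ∀ y ∈ Icc 0 (L/2), ∀ t ∈ Ico (T/2) T, -C ≤ pdt u 0 y t := by
  set K : Set (ℝ × ℝ × ℝ) := (Icc (-(L/2)) (L/2) ×ˢ (Icc 0 (L/2) ×ˢ Icc (T/2) T)) ∩
    {q | |q.1| = L/2 ∨ q.2.1 = L/2 ∨ q.2.2 ≤ 3*T/4} with hK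
  have hKc : IsCompact K := by
    refine (isCompact_Icc.prod (isCompact_Icc.prod isCompact_Icc)).inter_right ?_
    rw [ofPred_or, ofPred_or]
    refine IsClosed.union (isClosed_eq ?_ ?_) (IsClosed.union (isClosed_eq ?_ ?_)
      (isClosed_le ?_ ?_)) <;> fun_prop
  obtain ⟨N, hN0, hN⟩ := bdd_compact (g := fun q : ℝ × ℝ × ℝ => pdt u q.1 q.2.1 q.2.2) hKc (by
    rintro ⟨x, y, t⟩ ⟨⟨h1, h2, h3⟩, h4⟩
    simp only [mem_ofPred_eq] at h1 h2 h3 h4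
    refine (hext (abs_le.2 h1) h2 h3 ?_).2.2.2.2.2.2.2.2.2.1
    rintro ⟨rfl, rfl, rfl⟩
    rcases h4 with h4 | h4 | h4
    · simp at h4; linarith
    · linarith
    · linarith)
  refine ⟨N, hN0, fun y hy t ht => ?_⟩
  have hLa : 0 < L/2 := by linarith
  refine le_deriv_of_right (f := fun s => u 0 y s) (k0 := min (T/4) (T - t))
    (lt_min (by linarith) (by linarith [ht.2]))
    (hsol.smooth (by simpa using hL.le) ⟨hy.1, by linarith [hy.2]⟩
      ⟨by linarith [ht.1], ht.2⟩).2.2.1 ?_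
  intro s hs hs2
  have hs3 := hs2.trans_le (min_le_left _ _)
  have hs4 := hs2.trans_le (min_le_right _ _)
  have G1 : GoodSol p (L/2) (T/2) t u := good_self hsol hLa (by linarith) (by linarith) ht.2
  have G2 : GoodSol p (L/2) (T/2) t (shiftU u 0 0 s) := good_shift hsol hLa (by simp; linarith)
    le_rfl (by linarith) (by linarith) (by linarith)
  have := comparison (C := N * s) G1 G2 ?_ 0 y t (by simpa using hLa.le) hy ⟨ht.1, le_rfl⟩
  · simpa [shiftU] using this
  intro x y' t' hx hy' ht' hb
  simp only [shiftU, add_zero]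
  by_cases hy0 : y' = 0
  · subst hy0
    rw [hsol.bc (by linarith) ⟨by linarith [ht'.1], by linarith [ht'.2]⟩,
      hsol.bc (by linarith) ⟨by linarith [ht'.1], by linarith [ht'.2]⟩]
    have := mul_nonneg hN0 hs.le
    linarith
  have := mvt_abs (f := fun z => u x y' z) (a := t') (b := t' + s) (N := N) (by linarith)
    (fun z hz => (hsol.smooth (by linarith) ⟨hy'.1, by linarith [hy'.2]⟩
      ⟨by linarith [hz.1, ht'.1], by linarith [hz.2, ht'.2]⟩).2.2.1)
    (fun z hz => hN (x, y', z) ⟨⟨abs_le.1 hx, hy', by linarith [hz.1, ht'.1],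
      by linarith [hz.2, ht'.2]⟩, by
        simp only [mem_ofPred_eq]
        rcases hb with hb | hb | hb | hb
        · exact Or.inl hb
        · exact absurd hb hy0
        · exact Or.inr (Or.inl hb)
        · exact Or.inr (Or.inr (by linarith [hz.2]))⟩)
  rw [add_sub_cancel_left] at this
  linarith [(abs_le.1 this).1]

lemma tube {p L T : ℝ} {u : ℝ → ℝ → ℝ → ℝ} (hL : 0 < L)
    (hsol : ClassicalSolution p L T u) {t0 τ M : ℝ} (h0 : 0 < t0) (h1 : τ < T)
    (hM : ∀ t ∈ Icc t0 τ, pdy u 0 0 t ≤ M) :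
    ∃ k0, 0 < k0 ∧ k0 ≤ L ∧ ∀ k, 0 < k → k < k0 → ∀ t ∈ Icc t0 τ, u 0 k t ≤ (M + 1) * k := by
  have ev : ∀ᶠ y in nhds (0:ℝ), ∀ t ∈ Icc t0 τ, pdy u 0 y t < M + 1 := by
    refine isCompact_Icc.eventually_forall_of_forall_eventually ?_
    intro t ht
    have hc := (hsol.smooth (x := 0) (y := 0) (t := t) (by simpa using hL.le) ⟨le_rfl, hL.le⟩
      ⟨by linarith [ht.1], by linarith [ht.2]⟩).2.2.2.2.2.2.2.2.1
    have hm : ContinuousAt (fun z : ℝ × ℝ => ((0:ℝ), z.1, z.2)) (0, t) := by fun_prop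
    have := ContinuousAt.comp (f := fun z : ℝ × ℝ => ((0:ℝ), z.1, z.2))
      (g := fun q : ℝ × ℝ × ℝ => pdy u q.1 q.2.1 q.2.2) hc hm
    exact this.eventually_lt_const (u := M + 1) (by simpa using (hM t ht).trans_lt (by linarith))
  obtain ⟨k1, hk1, hk⟩ := Metric.eventually_nhds_iff.1 ev
  refine ⟨min k1 L, lt_min hk1 hL, min_le_right _ _, fun k hk0 hkk t ht => ?_⟩
  have hk2 := hkk.trans_le (min_le_left _ _)
  have hk3 := hkk.trans_le (min_le_right _ _)
  have htT : t ∈ Ioo 0 T := ⟨by linarith [ht.1], by linarith [ht.2]⟩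
  have hd : ∀ z ∈ Icc 0 k, DifferentiableAt ℝ (fun s => u 0 s t) z := fun z hz =>
    (hsol.smooth (by simpa using hL.le) ⟨hz.1, by linarith [hz.2]⟩ htT).2.1
  have := Convex.image_sub_le_mul_sub_of_deriv_le (f := fun s => u 0 s t) (C := M + 1)
    (convex_Icc 0 k)
    (fun z h => (hd z h).continuousAt.continuousWithinAt)
    (fun z h => (hd z (interior_subset h)).differentiableWithinAt)
    (fun z h => by
      have h := interior_subset h
      refine (hk (y := z) ?_ t ht).le
      rw [Real.dist_eq, sub_zero, abs_of_nonneg h.1]; linarith [h.2])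
    0 (left_mem_Icc.2 hk0.le) k (right_mem_Icc.2 hk0.le) hk0.le
  simp only [hsol.bc (show |(0:ℝ)| < L by simpa) htT] at this
  linarith

lemma grad_bound {p L T : ℝ} {u : ℝ → ℝ → ℝ → ℝ} (hL : 0 < L)
    (hsol : ClassicalSolution p L T u) (hgbu : IsolatedGBU L T u) (hmon : MonCond L T u)
    {t0 M : ℝ} (h0 : 0 < t0) (h1 : t0 < T) (hM : ∀ t ∈ Ico t0 T, pdy u 0 0 t ≤ M) :
    ∃ N, 0 ≤ N ∧ ∀ x y t, |x| ≤ L/2 → y ∈ Icc 0 (L/2) → t ∈ Ico t0 T →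
      |pdx u x y t| ≤ N ∧ |pdy u x y t| ≤ N := by
  obtain ⟨N1, hN1⟩ := hgbu.bounded ((Icc (-L) L ×ˢ Icc 0 L) ∩ {q | L/4 ≤ |q.1| ∨ L/4 ≤ q.2})
    ((isCompact_Icc.prod isCompact_Icc).inter_right (by
      rw [ofPred_or]
      refine IsClosed.union (isClosed_le ?_ ?_) (isClosed_le ?_ ?_) <;> fun_prop))
    (by
      rintro ⟨x, y⟩ ⟨h1, h2⟩
      refine ⟨h1, ?_⟩
      simp only [mem_ofPred_eq] at h2
      rintro h
      obtain ⟨rfl, rfl⟩ := Prod.mk.inj h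
      rcases h2 with h2 | h2
      · simp at h2; linarith
      · linarith)
  set K : Set (ℝ × ℝ × ℝ) := Icc (-L) L ×ˢ (Icc 0 L ×ˢ {t0}) with hK
  have hKc : IsCompact K := isCompact_Icc.prod (isCompact_Icc.prod isCompact_singleton)
  have hKs : ∀ q ∈ K, C21At u q.1 q.2.1 q.2.2 := by
    rintro ⟨x, y, t⟩ ⟨a1, a2, a3⟩
    simp only [mem_singleton_iff] at a1 a2 a3
    subst a3
    exact hsol.smooth (abs_le.2 a1) a2 ⟨h0, h1⟩
  obtain ⟨N2, hN20, hN2⟩ := bdd_compact (g := fun q : ℝ × ℝ × ℝ => pdx u q.1 q.2.1 q.2.2) hKc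
    (fun q hq => (hKs q hq).2.2.2.2.2.2.2.1)
  obtain ⟨N3, hN30, hN3⟩ := bdd_compact (g := fun q : ℝ × ℝ × ℝ => pdy u q.1 q.2.1 q.2.2) hKc
    (fun q hq => (hKs q hq).2.2.2.2.2.2.2.2.1)
  set N := max (max N1 (M + 1)) (max N2 N3) with hN
  have e1 : N1 ≤ N := (le_max_left _ _).trans (le_max_left _ _)
  have e2 : M + 1 ≤ N := (le_max_right _ _).trans (le_max_left _ _)
  have e3 : N2 ≤ N := (le_max_left _ _).trans (le_max_right _ _)
  have e4 : N3 ≤ N := (le_max_right _ _).trans (le_max_right _ _)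
  have hN0 : 0 ≤ N := hN20.trans e3
  have hbd : ∀ x y t, |x| ≤ L → y ∈ Icc 0 L → t ∈ Ico t0 T →
      (L/4 ≤ |x| ∨ L/4 ≤ y ∨ t = t0) → |pdx u x y t| ≤ N ∧ |pdy u x y t| ≤ N := by
    intro x y t hx hy ht hb
    by_cases htt : t = t0
    · subst htt
      exact ⟨(hN2 (x, y, t) ⟨abs_le.1 hx, hy, rfl⟩).trans e3,
        (hN3 (x, y, t) ⟨abs_le.1 hx, hy, rfl⟩).trans e4⟩
    · have h3 := hN1 (x, y) ⟨⟨abs_le.1 hx, hy⟩, by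
        simp only [mem_ofPred_eq]; tauto⟩ t ⟨by linarith [ht.1], ht.2⟩
      refine ⟨le_trans (Real.abs_le_sqrt ?_) (h3.trans e1), le_trans (Real.abs_le_sqrt ?_) (h3.trans e1)⟩ <;>
      nlinarith [sq_nonneg (pdx u x y t), sq_nonneg (pdy u x y t)]
  have hLa : 0 < L/2 := by linarith
  refine ⟨N, hN0, fun x y t hx hy ht => ⟨?_, ?_⟩⟩
  · have main : ∀ k, 0 < k → k < L/4 → |u (x + k) y t - u x y t| ≤ N * k := by
      intro k hk hk2
      have G1 : GoodSol p (L/2) t0 t u := good_self hsol hLa (by linarith) (by linarith) ht.2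
      have G2 : GoodSol p (L/2) t0 t (shiftU u k 0 0) := good_shift hsol hLa
        (by rw [abs_of_pos hk]; linarith) le_rfl (by linarith) (by linarith) (by linarith [ht.2])
      have B : ∀ x y t', |x| ≤ L/2 → y ∈ Icc (0:ℝ) (L/2) → t' ∈ Icc t0 t →
          (|x| = L/2 ∨ y = 0 ∨ y = L/2 ∨ t' = t0) → |u (x + k) y t' - u x y t'| ≤ N * k := by
        intro x y t' hx hy ht' hb
        have hT' : t' ∈ Ioo 0 T := ⟨by linarith [ht'.1], by linarith [ht'.2, ht.2]⟩
        obtain ⟨x1, x2⟩ := abs_le.1 hx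
        by_cases hy0 : y = 0
        · subst hy0
          rw [hsol.bc (by rw [abs_lt]; constructor <;> linarith) hT', hsol.bc (by linarith) hT']
          simpa using mul_nonneg hN0 hk.le
        have hzL : ∀ z ∈ Icc x (x + k), |z| ≤ L := fun z hz => by
          rw [abs_le]; constructor <;> linarith [hz.1, hz.2]
        have hyL : y ∈ Icc 0 L := ⟨hy.1, by linarith [hy.2]⟩
        have := mvt_abs (f := fun z => u z y t') (a := x) (b := x + k) (N := N) (by linarith)
          (fun z hz => (hsol.smooth (hzL z hz) hyL hT').1)
          (fun z hz => (hbd z y t' (hzL z hz) hyL ⟨ht'.1, hT'.2⟩ (by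
            rcases hb with hb | hb | hb | hb
            · left
              rw [le_abs]
              rcases eq_or_eq_neg_of_abs_eq hb with h | h
              · left; linarith [hz.1]
              · right; linarith [hz.2]
            · exact absurd hb hy0
            · right; left; linarith
            · right; right; exact hb)).1)
        rwa [add_sub_cancel_left] at this
      have c1 := comparison (C := N * k) G2 G1 (fun x y t' hx hy ht' hb => by
        simpa [shiftU] using (abs_le.1 (B x y t' hx hy ht' hb)).2) x y t hx hy ⟨ht.1, le_rfl⟩
      have c2 := comparison (C := N * k) G1 G2 (fun x y t' hx hy ht' hb => by
        have := (abs_le.1 (B x y t' hx hy ht' hb)).1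
        simp only [shiftU, add_zero]; linarith) x y t hx hy ⟨ht.1, le_rfl⟩
      simp only [shiftU, add_zero] at c1 c2
      rw [abs_le]; constructor <;> linarith
    have hd := (hsol.smooth (x := x) (y := y) (t := t) (by linarith) ⟨hy.1, by linarith [hy.2]⟩
      ⟨by linarith [ht.1], ht.2⟩).1
    rw [abs_le]
    exact ⟨le_deriv_of_right (f := fun s => u s y t) (k0 := L/4) (by linarith) hd
        (fun k h1 h2 => by linarith [(abs_le.1 (main k h1 h2)).1]),
      deriv_le_of_right (f := fun s => u s y t) (k0 := L/4) (by linarith) hd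
        (fun k h1 h2 => (abs_le.1 (main k h1 h2)).2)⟩
  · obtain ⟨k0, hk0, hk0L, htube⟩ := tube hL hsol h0 ht.2
      (fun t' ht' => hM t' ⟨ht'.1, by linarith [ht'.2, ht.2]⟩)
    have main : ∀ k, 0 < k → k < min (L/4) k0 → |u x (y + k) t - u x y t| ≤ N * k := by
      intro k hk hk'
      have hk2 := hk'.trans_le (min_le_left _ _)
      have hk3 := hk'.trans_le (min_le_right _ _)
      have G1 : GoodSol p (L/2) t0 t u := good_self hsol hLa (by linarith) (by linarith) ht.2
      have G2 : GoodSol p (L/2) t0 t (shiftU u 0 k 0) := good_shift hsol hLa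
        (by simp; linarith) hk.le (by linarith) (by linarith) (by linarith [ht.2])
      have B : ∀ x y t', |x| ≤ L/2 → y ∈ Icc (0:ℝ) (L/2) → t' ∈ Icc t0 t →
          (|x| = L/2 ∨ y = 0 ∨ y = L/2 ∨ t' = t0) → |u x (y + k) t' - u x y t'| ≤ N * k := by
        intro x y t' hx hy ht' hb
        have hT' : t' ∈ Ioo 0 T := ⟨by linarith [ht'.1], by linarith [ht'.2, ht.2]⟩
        by_cases hy0 : y = 0
        · subst hy0
          rw [hsol.bc (by linarith) hT', zero_add, sub_zero, abs_of_nonneg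
            (hsol.nonneg (by linarith) ⟨hk.le, by linarith⟩ hT')]
          refine (mon_axis hsol hmon (by linarith) ⟨hk, by linarith⟩ hT').trans ?_
          refine (htube k hk hk3 t' ht').trans ?_
          gcongr
        have hzL : ∀ z ∈ Icc y (y + k), z ∈ Icc 0 L := fun z hz => by
          constructor <;> linarith [hz.1, hz.2, hy.1, hy.2]
        have hxL : |x| ≤ L := by linarith
        have := mvt_abs (f := fun z => u x z t') (a := y) (b := y + k) (N := N) (by linarith)
          (fun z hz => (hsol.smooth hxL (hzL z hz) hT').2.1)
          (fun z hz => (hbd x z t' hxL (hzL z hz) ⟨ht'.1, hT'.2⟩ (by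
            rcases hb with hb | hb | hb | hb
            · left; linarith
            · exact absurd hb hy0
            · right; left; linarith [hz.1]
            · right; right; exact hb)).2)
        rwa [add_sub_cancel_left] at this
      have c1 := comparison (C := N * k) G2 G1 (fun x y t' hx hy ht' hb => by
        simpa [shiftU] using (abs_le.1 (B x y t' hx hy ht' hb)).2) x y t hx hy ⟨ht.1, le_rfl⟩
      have c2 := comparison (C := N * k) G1 G2 (fun x y t' hx hy ht' hb => by
        have := (abs_le.1 (B x y t' hx hy ht' hb)).1
        simp only [shiftU, add_zero]; linarith) x y t hx hy ⟨ht.1, le_rfl⟩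
      simp only [shiftU, add_zero] at c1 c2
      rw [abs_le]; constructor <;> linarith
    have hd := (hsol.smooth (x := x) (y := y) (t := t) (by linarith) ⟨hy.1, by linarith [hy.2]⟩
      ⟨by linarith [ht.1], ht.2⟩).2.1
    rw [abs_le]
    exact ⟨le_deriv_of_right (f := fun s => u x s t) (k0 := min (L/4) k0)
        (lt_min (by linarith) hk0) hd
        (fun k h1 h2 => by linarith [(abs_le.1 (main k h1 h2)).1]),
      deriv_le_of_right (f := fun s => u x s t) (k0 := min (L/4) k0)
        (lt_min (by linarith) hk0) hd
        (fun k h1 h2 => (abs_le.1 (main k h1 h2)).2)⟩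

lemma part_one {p L T : ℝ} {u : ℝ → ℝ → ℝ → ℝ} (hL : 0 < L) (hT : 0 < T)
    (hsol : ClassicalSolution p L T u) (hgbu : IsolatedGBU L T u) (hmon : MonCond L T u) :
    ∀ M : ℝ, ∀ δ > (0:ℝ), ∃ t : ℝ, T - δ < t ∧ t < T ∧ M < pdy u 0 0 t := by
  intro M δ hδ
  by_contra! hc
  set e := min (δ/2) (T/2) with he
  have he1 : e ≤ δ/2 := min_le_left _ _
  have he2 : e ≤ T/2 := min_le_right _ _
  have he0 : 0 < e := lt_min (by linarith) (by linarith)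
  obtain ⟨N, hN0, hN⟩ := grad_bound (t0 := T - e) (M := M) hL hsol hgbu hmon
    (by linarith) (by linarith) (fun t ht => hc t (by linarith [ht.1]) ht.2)
  obtain ⟨x, y, t, hx, hy, ht, hx1, hy1, ht1, hg⟩ := hgbu.blowup (2 * N) (min e (L/2))
    (lt_min he0 (by linarith))
  have m1 := min_le_left e (L/2)
  have m2 := min_le_right e (L/2)
  obtain ⟨g1, g2⟩ := hN x y t (by linarith) ⟨hy.1, by linarith [le_abs_self y]⟩
    ⟨by linarith, ht.2⟩
  refine absurd hg (not_lt.2 ?_)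
  refine Real.sqrt_le_iff.2 ⟨by linarith, ?_⟩
  have := sq_le_sq' (abs_le.1 g1).1 (abs_le.1 g1).2
  have := sq_le_sq' (abs_le.1 g2).1 (abs_le.1 g2).2
  nlinarith

lemma ode_compare {p C y1 η : ℝ} (hp : 2 < p) (hy1 : 0 < y1) (hη : 0 < η) {v v' : ℝ → ℝ}
    (hpos : ∀ y ∈ Icc 0 y1, (C + 1) * y ≤ (1/(p-1) : ℝ) ^ (1/(p-1)) * (y + η) ^ (-(1/(p-1))))
    (hC : 0 ≤ C)
    (hv : ∀ y ∈ Icc 0 y1, HasDerivAt v (v' y) y)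
    (hode : ∀ y ∈ Ioo 0 y1, -C - |v y| ^ p ≤ v' y)
    (h0 : (1/(p-1) : ℝ) ^ (1/(p-1)) * η ^ (-(1/(p-1))) < v 0) :
    ∀ y ∈ Icc 0 y1, (1/(p-1) : ℝ) ^ (1/(p-1)) * (y + η) ^ (-(1/(p-1))) - (C + 1) * y ≤ v y := by
  set β : ℝ := 1/(p-1) with hβ
  have hβ0 : 0 < β := by apply one_div_pos.2; linarith
  have hβp : β * p = β + 1 := by
    have : p - 1 ≠ 0 := by linarith
    rw [hβ]; field_simp; ring
  have hder : ∀ y, 0 ≤ y → HasDerivAt (fun y => β ^ β * (y + η) ^ (-β) - (C + 1) * y)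
      (-(β ^ β * (y + η) ^ (-β)) ^ p - (C + 1)) y := by
    intro y hy
    have hyη : 0 < y + η := by linarith
    have h1 : HasDerivAt (fun y : ℝ => (y + η) ^ (-β)) (1 * (-β) * (y + η) ^ (-β - 1)) y :=
      ((hasDerivAt_id y).add_const η).rpow_const (Or.inl hyη.ne')
    have h2 := (h1.const_mul (β ^ β)).sub ((hasDerivAt_id y).const_mul (C + 1))
    refine h2.congr_deriv ?_
    rw [Real.mul_rpow (by positivity) (by positivity), ← Real.rpow_mul hβ0.le,
      ← Real.rpow_mul hyη.le, neg_mul, hβp, Real.rpow_add hβ0, Real.rpow_one,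
      show -(β + 1) = -β - 1 by ring]
    ring
  intro y hy
  refine image_le_of_deriv_right_lt_deriv_boundary'
    (f := fun y => β ^ β * (y + η) ^ (-β) - (C + 1) * y) (a := 0) (b := y1)
    (f' := fun y => -(β ^ β * (y + η) ^ (-β)) ^ p - (C + 1)) (B := v) (B' := v')
    (fun z hz => (hder z hz.1).continuousAt.continuousWithinAt)
    (fun z hz => (hder z hz.1).hasDerivWithinAt) (by simpa using h0.le)
    (fun z hz => (hv z hz).continuousAt.continuousWithinAt)
    (fun z hz => (hv z ⟨hz.1, hz.2.le⟩).hasDerivWithinAt) ?_ hy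
  intro z hz hfz
  rcases hz.1.eq_or_lt with h | h
  · subst h
    simp only [zero_add, mul_zero, sub_zero] at hfz
    linarith
  · have h2 := hode z ⟨h, hz.2⟩
    have h3 := hpos z ⟨hz.1, hz.2.le⟩
    have h4 : |v z| ^ p ≤ (β ^ β * (z + η) ^ (-β)) ^ p := by
      rw [← hfz]
      have h5 : 0 ≤ (C + 1) * z := by positivity
      apply Real.rpow_le_rpow (abs_nonneg _) _ (by linarith)
      rw [abs_of_nonneg (by linarith)]
      linarith
    linarith


lemma part_two {p L T : ℝ} {u : ℝ → ℝ → ℝ → ℝ} (hp : 2 < p) (hL : 0 < L) (hT : 0 < T)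
    (hsol : ClassicalSolution p L T u) (hext : ExtC21 L T u) (hmon : MonCond L T u)
    (h1 : ∀ M : ℝ, ∀ δ > (0:ℝ), ∃ t : ℝ, T - δ < t ∧ t < T ∧ M < pdy u 0 0 t) :
    ∃ C₁ : ℝ, 0 < C₁ ∧ ∀ y : ℝ, 0 < y → y < L/2 →
      ((1/(p-1) : ℝ) ^ (1/(p-1))) * y ^ (-(1/(p-1))) - C₁ ≤ pdy u 0 y T := by
  obtain ⟨C, hC, hut⟩ := ut_lower hL hT hsol hext
  have hβ0 : 0 < 1/(p-1) := by apply one_div_pos.2; linarith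
  set c : ℝ := (1/(p-1) : ℝ) ^ (1/(p-1)) with hc
  have hc0 : 0 < c := by positivity
  set y1 : ℝ := min (min (1/2) (L/4)) (c / (C + 1)) with hy1d
  have a1 : y1 ≤ 1/2 := (min_le_left _ _).trans (min_le_left _ _)
  have a2 : y1 ≤ L/4 := (min_le_left _ _).trans (min_le_right _ _)
  have a3 : y1 ≤ c / (C + 1) := min_le_right _ _
  have hy1 : 0 < y1 := by
    apply lt_min (lt_min (by norm_num) (by linarith)); positivity
  rw [le_div_iff₀ (by linarith)] at a3
  have hcT : ∀ y, 0 < y → y ≤ L/2 →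
      ContinuousAt (fun q : ℝ × ℝ × ℝ => pdy u q.1 q.2.1 q.2.2) (0, y, T) := fun y h2 h3 =>
    (hext (by simp; linarith) ⟨h2.le, h3⟩ ⟨by linarith, le_rfl⟩
      (fun h => h2.ne' h.2.1)).2.2.2.2.2.2.2.2.1
  -- near region
  have near : ∀ y, 0 < y → y ≤ y1 → ∀ η, 0 < η → η < y1 →
      c * (y + η) ^ (-(1/(p-1))) - (C + 1) * y ≤ pdy u 0 y T := by
    intro y hy hyy η hη hηy
    by_contra! hlt
    have hm : ContinuousAt (fun t : ℝ => ((0:ℝ), y, t)) T := by fun_prop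
    have hct := ContinuousAt.comp (f := fun t : ℝ => ((0:ℝ), y, t))
      (g := fun q : ℝ × ℝ × ℝ => pdy u q.1 q.2.1 q.2.2) (hcT y hy (by linarith)) hm
    have ev := hct.eventually_lt_const hlt
    obtain ⟨δ, hδ, hev⟩ := Metric.eventually_nhds_iff.1 ev
    obtain ⟨t, ht1, ht2, ht3⟩ := h1 (c * η ^ (-(1/(p-1)))) (min δ (T/2)) (lt_min hδ (by linarith))
    have m1 := min_le_left δ (T/2)
    have m2 := min_le_right δ (T/2)
    have htT : t ∈ Ioo 0 T := ⟨by linarith, ht2⟩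
    have hlt2 := hev (y := t) (by rw [Real.dist_eq, abs_lt]; constructor <;> linarith)
    refine absurd hlt2 (not_lt.2 ?_)
    refine ode_compare (v := fun z => pdy u 0 z t) (v' := fun z => pdyy u 0 z t) (C := C)
      hp hy1 hη ?_ hC ?_ ?_ ht3 y ⟨hy.le, hyy⟩
    · intro z hz
      rw [← hc]
      have h5 : 1 ≤ (z + η) ^ (-(1/(p-1))) :=
        Real.one_le_rpow_of_pos_of_le_one_of_nonpos (by linarith [hz.1]) (by linarith [hz.2])
          (by linarith)
      nlinarith [hz.1, hz.2]
    · intro z hz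
      exact (hsol.smooth (by simpa using hL.le) ⟨hz.1, by linarith [hz.2]⟩ htT).2.2.2.2.1.hasDerivAt
    · intro z hz
      obtain ⟨x1, x2⟩ := axis_max hL hsol hmon (y := z) (t := t) ⟨hz.1, by linarith [hz.2]⟩ htT
      have P := hsol.pde (x := 0) (y := z) (t := t) (by simpa) ⟨hz.1, by linarith [hz.2]⟩ htT
      have g : gradNorm u 0 z t = |pdy u 0 z t| := by
        unfold gradNorm
        rw [x1, ← Real.sqrt_sq_eq_abs]; norm_num
      rw [g] at P
      have := hut z ⟨hz.1.le, by linarith [hz.2]⟩ t ⟨by linarith, ht2⟩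
      linarith
  have near2 : ∀ y, 0 < y → y ≤ y1 →
      c * y ^ (-(1/(p-1))) - (C + 1) * y ≤ pdy u 0 y T := by
    intro y hy hyy
    have hcont : ContinuousAt (fun η : ℝ => c * (y + η) ^ (-(1/(p-1))) - (C + 1) * y) 0 := by
      have : ContinuousAt (fun η : ℝ => (y + η) ^ (-(1/(p-1)))) 0 :=
        ContinuousAt.rpow_const (by fun_prop) (Or.inl (by simpa using hy.ne'))
      exact (this.const_mul c).sub continuousAt_const
    have h6 := hcont.tendsto.mono_left (nhdsWithin_le_nhds (s := Ioi 0))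
    simp only [add_zero] at h6
    refine le_of_tendsto h6 ?_
    filter_upwards [Ioo_mem_nhdsGT hy1] with η hη using near y hy hyy η hη.1 hη.2
  obtain ⟨N, hN0, hN⟩ := bdd_compact (g := fun q : ℝ × ℝ × ℝ => pdy u q.1 q.2.1 q.2.2)
    (K := {0} ×ˢ (Icc y1 (L/2) ×ˢ {T}))
    (isCompact_singleton.prod (isCompact_Icc.prod isCompact_singleton)) (by
      rintro ⟨x, y, t⟩ ⟨b1, b2, b3⟩
      simp only [mem_singleton_iff] at b1 b2 b3
      subst b1 b3
      exact hcT y (by linarith [b2.1]) b2.2)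
  have hq : 0 ≤ c * y1 ^ (-(1/(p-1))) := by positivity
  refine ⟨(C + 1) * y1 + N + c * y1 ^ (-(1/(p-1))), by positivity, fun y hy hy2 => ?_⟩
  rcases le_total y y1 with h | h
  · have := near2 y hy h
    have : (C + 1) * y ≤ (C + 1) * y1 := by gcongr
    linarith
  · have := (abs_le.1 (hN (0, y, T) ⟨rfl, ⟨h, hy2.le⟩, rfl⟩)).1
    have h7 : y ^ (-(1/(p-1))) ≤ y1 ^ (-(1/(p-1))) :=
      Real.rpow_le_rpow_of_nonpos hy1 h (by linarith)
    have h8 : c * y ^ (-(1/(p-1))) ≤ c * y1 ^ (-(1/(p-1))) := by gcongr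
    have h9 : 0 ≤ (C + 1) * y1 := by positivity
    simp only at this
    linarith

/-- Lemma 2.7: `limsup_{t→T⁻} u_y(0,0,t) = +∞`, and the final profile on the
line `x = 0` satisfies `u_y(0,y,T) ≥ d_p y^{-β} - C₁` for `0 < y < L/2`,
where `β = 1/(p-1)` and `d_p = β^β`. -/
theorem limsup_uy_and_profile_on_axis (p L T : ℝ) (hp : 2 < p)
    (hL : 0 < L) (hT : 0 < T) (u : ℝ → ℝ → ℝ → ℝ)
    (hsol : ClassicalSolution p L T u) (hgbu : IsolatedGBU L T u)
    (hext : ExtC21 L T u) (hmon : MonCond L T u) :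
    (∀ M : ℝ, ∀ δ > (0:ℝ), ∃ t : ℝ, T - δ < t ∧ t < T ∧ M < pdy u 0 0 t) ∧
    (∃ C₁ : ℝ, 0 < C₁ ∧ ∀ y : ℝ, 0 < y → y < L/2 →
      ((1/(p-1) : ℝ) ^ (1/(p-1))) * y ^ (-(1/(p-1))) - C₁ ≤ pdy u 0 y T) := by

  have h1 := part_one hL hT hsol hgbu hmon
  exact ⟨h1, part_two hp hL hT hsol hext hmon h1⟩
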